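/- Let σ be a partition of the primes. The class of finite σ-SC-groups (groups all of whose chief factors below the σ-nilpotent residual are simple) is a formation closed under taking normal subgroups: it is closed under homomorphic images, subdirect products (G/R, G/N σ-SC with R ∩ N = 1 implies G is σ-SC), and normal subgroups. -/

import Mathlib

open Subgroup
open scoped Pointwise

section Defs

variable {ι : Type*}

/-- `σ` is a partition of the set of all primes. -/
structure IsPrimePartition (σ : ι → Set ℕ) : Prop where
  prime_of_mem : ∀ i p, p ∈ σ i → p.Prime
  existsUnique_mem : ∀ p : ℕ, p.Prime → ∃! i, p ∈ σ i

/-- every prime dividing `n` lies in the block `σ i`. -/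
def IsSigmaNumber (σ : ι → Set ℕ) (i : ι) (n : ℕ) : Prop :=
  ∀ p : ℕ, p.Prime → p ∣ n → p ∈ σ i

/-- `G` is a `σ i`-group. -/
def IsSigmaIGroup (σ : ι → Set ℕ) (i : ι) (G : Type*) [Group G] : Prop :=
  IsSigmaNumber σ i (Nat.card G)

/-- `G` is σ-primary: it is a `σ i`-group for some `i`. -/
def IsSigmaPrimary (σ : ι → Set ℕ) (G : Type*) [Group G] : Prop :=
  ∃ i, IsSigmaIGroup σ i G

/-- `G` is σ-nilpotent: `G` is the internal direct product of normal
σ-primary subgroups (one `σ i`-subgroup for each block). -/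
def IsSigmaNilpotent (σ : ι → Set ℕ) (G : Type*) [Group G] : Prop :=
  ∃ H : ι → Subgroup G, (∀ i, (H i).Normal) ∧ (∀ i, IsSigmaIGroup σ i ↥(H i)) ∧
    iSupIndep H ∧ iSup H = ⊤

/-- One step in a σ-subnormal chain: `A ≤ B` and either `A` is normal in `B` or
`B/(A_B)` (quotient by the normal core of `A` in `B`) is σ-primary. -/
def SigmaSubnormalStep (σ : ι → Set ℕ) {G : Type*} [Group G] (A B : Subgroup G) : Prop :=
  A ≤ B ∧ (((A.subgroupOf B).Normal) ∨
    IsSigmaPrimary σ (↥B ⧸ (A.subgroupOf B).normalCore))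

/-- `A` is σ-subnormal in `G`. -/
def IsSigmaSubnormal (σ : ι → Set ℕ) {G : Type*} [Group G] (A : Subgroup G) : Prop :=
  ∃ n, ∃ C : Fin (n + 1) → Subgroup G, C 0 = A ∧ C (Fin.last n) = ⊤ ∧
    ∀ k : Fin n, SigmaSubnormalStep σ (C k.castSucc) (C k.succ)

/-- `A` is subnormal in `G`. -/
def IsSubnormalSub {G : Type*} [Group G] (A : Subgroup G) : Prop :=
  ∃ n, ∃ C : Fin (n + 1) → Subgroup G, C 0 = A ∧ C (Fin.last n) = ⊤ ∧
    ∀ k : Fin n, C k.castSucc ≤ C k.succ ∧ ((C k.castSucc).subgroupOf (C k.succ)).Normal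

/-- `M` is a modular subgroup of `G`: a modular element of the subgroup lattice. -/
def IsModularSubgroup {G : Type*} [Group G] (M : Subgroup G) : Prop :=
  (∀ X Z : Subgroup G, X ≤ Z → X ⊔ (M ⊓ Z) = (X ⊔ M) ⊓ Z) ∧
  (∀ Y Z : Subgroup G, M ≤ Z → M ⊔ (Y ⊓ Z) = (M ⊔ Y) ⊓ Z)

/-- `A` is submodular in `G`: there is a chain from `A` to `G` with each
term modular in the next. -/
def IsSubmodular {G : Type*} [Group G] (A : Subgroup G) : Prop :=
  ∃ n, ∃ C : Fin (n + 1) → Subgroup G, C 0 = A ∧ C (Fin.last n) = ⊤ ∧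
    ∀ k : Fin n, C k.castSucc ≤ C k.succ ∧
      IsModularSubgroup ((C k.castSucc).subgroupOf (C k.succ))

/-- `H` is a Hall `σ i`-subgroup of `G`. -/
def IsHallSigmaI (σ : ι → Set ℕ) (i : ι) {G : Type*} [Group G] (H : Subgroup G) : Prop :=
  IsSigmaNumber σ i (Nat.card H) ∧ ∀ p : ℕ, p.Prime → p ∣ H.index → p ∉ σ i

/-- `G` is σ-full: it has a Hall `σ i`-subgroup for every `σ i ∈ σ(G)`. -/
def IsSigmaFull (σ : ι → Set ℕ) (G : Type*) [Group G] : Prop :=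
  ∀ i, (∃ p : ℕ, p.Prime ∧ p ∈ σ i ∧ p ∣ Nat.card G) →
    ∃ H : Subgroup G, IsHallSigmaI σ i H

/-- Two subgroups permute. -/
def Permutes {G : Type*} [Group G] (A B : Subgroup G) : Prop :=
  (A : Set G) * (B : Set G) = (B : Set G) * (A : Set G)

/-- `A` is σ-permutable in `G`: it permutes with every Hall `σ i`-subgroup of `G`
(hence with all their conjugates). -/
def IsSigmaPermutable (σ : ι → Set ℕ) {G : Type*} [Group G] (A : Subgroup G) : Prop :=
  ∀ i, ∀ H : Subgroup G, IsHallSigmaI σ i H → Permutes A H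

/-- `A` is quasinormal (permutable) in `G`. -/
def IsQuasinormal {G : Type*} [Group G] (A : Subgroup G) : Prop :=
  ∀ B : Subgroup G, Permutes A B

/-- `A` is σ-quasinormal in `G`: modular and σ-subnormal. -/
def IsSigmaQuasinormal (σ : ι → Set ℕ) {G : Type*} [Group G] (A : Subgroup G) : Prop :=
  IsModularSubgroup A ∧ IsSigmaSubnormal σ A

/-- σ-permutability is a transitive relation on `G`. -/
def IsPSigmaTGroup (σ : ι → Set ℕ) (G : Type*) [Group G] : Prop :=
  ∀ K H : Subgroup G, H ≤ K → IsSigmaPermutable σ (H.subgroupOf K) →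
    IsSigmaPermutable σ K → IsSigmaPermutable σ H

/-- `H/K` is a chief factor of `G`. -/
def IsChiefFactor (G : Type*) [Group G] (K H : Subgroup G) : Prop :=
  K.Normal ∧ H.Normal ∧ K < H ∧
    ∀ N : Subgroup G, N.Normal → K ≤ N → N ≤ H → N = K ∨ N = H

/-- `G` is σ-soluble: every chief factor of `G` is σ-primary. -/
def IsSigmaSoluble (σ : ι → Set ℕ) (G : Type*) [Group G] : Prop :=
  ∀ K H : Subgroup G, ∀ hc : IsChiefFactor G K H,
    letI := hc.1; IsSigmaPrimary σ (↥H ⧸ K.subgroupOf H)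

/-- The σ-nilpotent residual `G^{𝔑_σ}` of `G`. -/
def sigmaNilpotentResidual (σ : ι → Set ℕ) (G : Type*) [Group G] : Subgroup G :=
  sInf {N : Subgroup G | ∃ h : N.Normal, letI := h; IsSigmaNilpotent σ (G ⧸ N)}

/-- The σ-soluble residual `G^{𝔖_σ}` of `G`. -/
def sigmaSolubleResidual (σ : ι → Set ℕ) (G : Type*) [Group G] : Subgroup G :=
  sInf {N : Subgroup G | ∃ h : N.Normal, letI := h; IsSigmaSoluble σ (G ⧸ N)}

/-- `G` is a σ-SC-group: every chief factor of `G` below `G^{𝔑_σ}` is simple. -/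
def IsSigmaSCGroup (σ : ι → Set ℕ) (G : Type*) [Group G] : Prop :=
  ∀ K H : Subgroup G, ∀ hc : IsChiefFactor G K H, H ≤ sigmaNilpotentResidual σ G →
    letI := hc.1; IsSimpleGroup (↥H ⧸ K.subgroupOf H)

/-- `G` is σ-supersoluble: every chief factor of `G` below `G^{𝔑_σ}` is cyclic. -/
def IsSigmaSupersoluble (σ : ι → Set ℕ) (G : Type*) [Group G] : Prop :=
  ∀ K H : Subgroup G, ∀ hc : IsChiefFactor G K H, H ≤ sigmaNilpotentResidual σ G →
    letI := hc.1; IsCyclic (↥H ⧸ K.subgroupOf H)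

/-- The σ-supersoluble residual `G^{𝔘_σ}` of `G`. -/
def sigmaSupersolubleResidual (σ : ι → Set ℕ) (G : Type*) [Group G] : Subgroup G :=
  sInf {N : Subgroup G | ∃ h : N.Normal, letI := h; IsSigmaSupersoluble σ (G ⧸ N)}

/-- The soluble radical `G_𝔖`: the largest soluble normal subgroup of `G`. -/
def solubleRadical (G : Type*) [Group G] : Subgroup G :=
  sSup {N : Subgroup G | N.Normal ∧ IsSolvable ↥N}

/-- `O_{σ i}(G)`: the largest normal `σ i`-subgroup of `G`. -/
def sigmaCore (σ : ι → Set ℕ) (i : ι) (G : Type*) [Group G] : Subgroup G :=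
  sSup {N : Subgroup G | N.Normal ∧ IsSigmaIGroup σ i ↥N}

/-- `O^{σ i}(G)`: the smallest normal subgroup of `G` with `σ i`-quotient. -/
def sigmaIResidual (σ : ι → Set ℕ) (i : ι) (G : Type*) [Group G] : Subgroup G :=
  sInf {N : Subgroup G | ∃ h : N.Normal, letI := h; IsSigmaIGroup σ i (G ⧸ N)}

end Defs

section Nilp

variable {ι : Type*} {σ : ι → Set ℕ}

theorem prime_dvd_card_sup {G : Type*} [Group G] (A B : Subgroup G) [B.Normal]
    {p : ℕ} (hp : p.Prime) (h : p ∣ Nat.card ↥(A ⊔ B)) :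
    p ∣ Nat.card A ∨ p ∣ Nat.card B := by
  have h1 := relIndex_mul_relIndex ⊥ B (A ⊔ B) bot_le le_sup_right
  rw [relIndex_bot_left, relIndex_bot_left, relIndex_sup_right] at h1
  rw [← h1] at h
  rcases (Nat.Prime.dvd_mul hp).1 h with h | h
  · exact Or.inr h
  · exact Or.inl (h.trans (relIndex_dvd_card _ _))

theorem prime_dvd_card_iSup {G : Type*} [Group G] [Finite G] {κ : Sort*} (H : κ → Subgroup G)
    (hn : ∀ i, (H i).Normal) {p : ℕ} (hp : p.Prime) (h : p ∣ Nat.card ↥(iSup H)) :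
    ∃ i, p ∣ Nat.card (H i) := by
  by_contra hcon
  push Not at hcon
  obtain ⟨M, hM⟩ := (Set.toFinite {M : Subgroup G | M.Normal ∧ ¬ p ∣ Nat.card M}).exists_maximal
    ⟨⊥, inferInstance, by simpa using hp.one_lt.ne'⟩
  have hle : iSup H ≤ M := by
    refine iSup_le fun i => ?_
    have := hM.prop.1
    have := hn i
    have hm : (H i ⊔ M) ∈ {M : Subgroup G | M.Normal ∧ ¬ p ∣ Nat.card M} := by
      refine ⟨inferInstance, fun hd => ?_⟩
      rcases prime_dvd_card_sup _ _ hp hd with h | h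
      · exact hcon i h
      · exact hM.prop.2 h
    exact le_sup_left.trans (hM.le_of_ge hm le_sup_right)
  exact hM.prop.2 (h.trans (card_dvd_of_le hle))

/-- weak form of sigma-nilpotency, without independence. -/
def WeakNil (σ : ι → Set ℕ) (G : Type*) [Group G] : Prop :=
  ∃ H : ι → Subgroup G, (∀ i, (H i).Normal) ∧ (∀ i, IsSigmaIGroup σ i ↥(H i)) ∧ iSup H = ⊤

/-- elementwise form of sigma-nilpotency. -/
def EltNil (σ : ι → Set ℕ) (G : Type*) [Group G] : Prop :=
  ∃ H : ι → Subgroup G, ∀ i x, x ∈ H i ↔ IsSigmaNumber σ i (orderOf x)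

theorem coprime_compl (hσ : IsPrimePartition σ) {G : Type*} [Group G] [Finite G]
    (H : ι → Subgroup G) (hn : ∀ i, (H i).Normal) (hc : ∀ i, IsSigmaIGroup σ i ↥(H i)) (i : ι)
    {n : ℕ} (hn' : IsSigmaNumber σ i n) :
    Nat.Coprime n (Nat.card ↥(⨆ j, ⨆ (_ : j ≠ i), H j)) := by
  refine Nat.Coprime.symm (Nat.coprime_of_dvd ?_)
  intro p hp h1 h2
  obtain ⟨j, hj⟩ := prime_dvd_card_iSup _
    (fun j => (have := hn j; Subgroup.iSup_normal _)) hp h1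
  obtain ⟨hji, hj⟩ := prime_dvd_card_iSup _ (fun _ => hn j) hp hj
  exact hji ((hσ.existsUnique_mem p hp).unique (hc j p hp hj) (hn' p hp h2))

theorem WeakNil.nil (hσ : IsPrimePartition σ) {G : Type*} [Group G] [Finite G]
    (h : WeakNil σ G) : IsSigmaNilpotent σ G := by
  obtain ⟨H, hn, hc, ht⟩ := h
  refine ⟨H, hn, hc, fun i => ?_, ht⟩
  rw [disjoint_iff]
  exact inf_eq_bot_of_coprime (coprime_compl hσ H hn hc i (hc i))

theorem IsSigmaNilpotent.weak {G : Type*} [Group G] (h : IsSigmaNilpotent σ G) : WeakNil σ G := by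
  obtain ⟨H, hn, hc, _, ht⟩ := h
  exact ⟨H, hn, hc, ht⟩

theorem WeakNil.elt (hσ : IsPrimePartition σ) {G : Type*} [Group G] [Finite G]
    (h : WeakNil σ G) : EltNil σ G := by
  obtain ⟨H, hn, hc, ht⟩ := h
  refine ⟨H, fun i x => ⟨fun hx p hp hd => hc i p hp (hd.trans ?_), fun hx => ?_⟩⟩
  · exact Subgroup.orderOf_dvd_natCard _ hx
  · have := hn i
    set T := ⨆ j, ⨆ (_ : j ≠ i), H j with hT
    have htop : T ⊔ H i = ⊤ := by
      rw [eq_top_iff, ← ht]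
      refine iSup_le fun j => ?_
      by_cases hj : j = i
      · subst hj; exact le_sup_right
      · exact le_sup_of_le_left (le_iSup₂_of_le j hj le_rfl)
    have hidx : (H i).index ∣ Nat.card T := by
      rw [← relIndex_top_right, ← htop, relIndex_sup_right]
      exact relIndex_dvd_card _ _
    have hcop := (coprime_compl hσ H hn hc i hx).coprime_dvd_right hidx
    have h1 : ((x : G ⧸ H i)) ^ orderOf x = 1 := by
      rw [← QuotientGroup.mk_pow, pow_orderOf_eq_one]; rfl
    have h2 : ((x : G ⧸ H i)) ^ (H i).index = 1 := pow_card_eq_one'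
    have h3 := Nat.dvd_gcd (orderOf_dvd_of_pow_eq_one h1) (orderOf_dvd_of_pow_eq_one h2)
    rw [hcop.gcd_eq_one, Nat.dvd_one, orderOf_eq_one_iff] at h3
    exact (QuotientGroup.eq_one_iff x).1 h3

theorem EltNil.weak (hσ : IsPrimePartition σ) {G : Type*} [Group G] [Finite G]
    (h : EltNil σ G) : WeakNil σ G := by
  obtain ⟨H, hH⟩ := h
  refine ⟨H, fun i => ⟨fun x hx g => ?_⟩, fun i p hp hd => ?_, ?_⟩
  · rw [hH] at hx ⊢
    have : orderOf (g * x * g⁻¹) = orderOf x := by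
      have := orderOf_injective (MulAut.conj g).toMonoidHom (MulAut.conj g).injective x
      simpa using this
    rwa [this]
  · have := Fact.mk hp
    obtain ⟨x, hx⟩ := exists_prime_orderOf_dvd_card' p hd
    have h1 := (hH i x).1 x.2
    rw [Subgroup.orderOf_coe, hx] at h1
    exact h1 p hp dvd_rfl
  · by_contra hne
    have hidx : (iSup H).index ≠ 1 := by rwa [Ne, index_eq_one]
    obtain ⟨p, hp, hd⟩ := Nat.exists_prime_and_dvd hidx
    have := Fact.mk hp
    obtain ⟨P⟩ : Nonempty (Sylow p G) := inferInstance
    obtain ⟨i, hi, _⟩ := hσ.existsUnique_mem p hp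
    have hle : (P : Subgroup G) ≤ iSup H := by
      refine le_trans (fun x hx => ?_) (le_iSup H i)
      rw [hH]
      obtain ⟨k, hk⟩ := IsPGroup.iff_orderOf.1 P.isPGroup' ⟨x, hx⟩
      rw [Subgroup.orderOf_mk] at hk
      rw [hk]
      intro q hq hqd
      rw [(Nat.prime_dvd_prime_iff_eq hq hp).1 (hq.dvd_of_dvd_pow hqd)]
      exact hi
    exact P.not_dvd_index (hd.trans (index_dvd_of_le hle))

theorem EltNil.subdirect {G A B : Type*} [Group G] [Group A] [Group B] (f : G →* A) (g : G →* B)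
    (hfg : f.ker ⊓ g.ker = ⊥) (hA : EltNil σ A) (hB : EltNil σ B) : EltNil σ G := by
  obtain ⟨H, hH⟩ := hA
  obtain ⟨K, hK⟩ := hB
  refine ⟨fun i => (H i).comap f ⊓ (K i).comap g, fun i x => ?_⟩
  rw [mem_inf, mem_comap, mem_comap, hH, hK]
  constructor
  · rintro ⟨h1, h2⟩ p hp hd
    have : orderOf x ∣ orderOf (f x) * orderOf (g x) := by
      apply orderOf_dvd_of_pow_eq_one
      have : x ^ (orderOf (f x) * orderOf (g x)) ∈ f.ker ⊓ g.ker := by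
        constructor
        · change f _ = 1
          rw [map_pow, pow_mul, pow_orderOf_eq_one, one_pow]
        · change g _ = 1
          rw [map_pow, mul_comm, pow_mul, pow_orderOf_eq_one, one_pow]
      rwa [hfg, mem_bot] at this
    rcases hp.dvd_mul.1 (hd.trans this) with h | h
    · exact h1 p hp h
    · exact h2 p hp h
  · intro h
    exact ⟨fun p hp hd => h p hp (hd.trans (orderOf_map_dvd f x)),
      fun p hp hd => h p hp (hd.trans (orderOf_map_dvd g x))⟩

theorem EltNil.of_injective {G A : Type*} [Group G] [Group A] (f : G →* A)
    (hf : Function.Injective f) (hA : EltNil σ A) : EltNil σ G :=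
  hA.subdirect f f (by rw [inf_idem]; exact (MonoidHom.ker_eq_bot_iff f).2 hf) hA

theorem WeakNil.of_surjective {G A : Type*} [Group G] [Group A] (f : G →* A)
    (hf : Function.Surjective f) (h : WeakNil σ G) : WeakNil σ A := by
  obtain ⟨H, hn, hc, ht⟩ := h
  refine ⟨fun i => (H i).map f, fun i => (hn i).map f hf, fun i p hp hd => ?_, ?_⟩
  · exact hc i p hp (hd.trans (Subgroup.card_map_dvd _ _))
  · rw [← Subgroup.map_iSup, ht, ← MonoidHom.range_eq_map, MonoidHom.range_eq_top.2 hf]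

theorem nil_iff_elt (hσ : IsPrimePartition σ) {G : Type*} [Group G] [Finite G] :
    IsSigmaNilpotent σ G ↔ EltNil σ G :=
  ⟨fun h => h.weak.elt hσ, fun h => (h.weak hσ).nil hσ⟩

theorem residual_mem (hσ : IsPrimePartition σ) (G : Type*) [Group G] [Finite G] :
    ∃ h : (sigmaNilpotentResidual σ G).Normal,
      letI := h; IsSigmaNilpotent σ (G ⧸ sigmaNilpotentResidual σ G) := by
  set s : Set (Subgroup G) :=
    {N : Subgroup G | ∃ h : N.Normal, letI := h; IsSigmaNilpotent σ (G ⧸ N)} with hs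
  have hcl : InfClosed s := by
    rintro A ⟨hA, hA'⟩ B ⟨hB, hB'⟩
    refine ⟨inferInstance, ?_⟩
    refine (nil_iff_elt hσ).2 (EltNil.subdirect
      (QuotientGroup.map (A ⊓ B) A (MonoidHom.id G) inf_le_left)
      (QuotientGroup.map (A ⊓ B) B (MonoidHom.id G) inf_le_right) ?_
      ((nil_iff_elt hσ).1 hA') ((nil_iff_elt hσ).1 hB'))
    rw [eq_bot_iff]
    intro x
    induction x using QuotientGroup.induction_on with
    | H x =>
      rintro ⟨h1, h2⟩
      have h1' : ((x : G) : G ⧸ A) = 1 := h1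
      have h2' : ((x : G) : G ⧸ B) = 1 := h2
      rw [QuotientGroup.eq_one_iff] at h1' h2'
      exact (QuotientGroup.eq_one_iff x).2 ⟨h1', h2'⟩
  have htop : (⊤ : Subgroup G) ∈ s := by
    refine ⟨inferInstance, ?_⟩
    refine (nil_iff_elt hσ).2 ⟨fun _ => ⊤, fun i x => ?_⟩
    have : x = 1 := by
      induction x using QuotientGroup.induction_on with
      | H x => exact (QuotientGroup.eq_one_iff x).2 trivial
    subst this
    simp only [mem_top, orderOf_one, true_iff]
    intro p hp hd
    exact absurd (Nat.dvd_one.1 hd) hp.one_lt.ne'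
  exact hcl.sInf_mem (Set.toFinite s) htop subset_rfl

theorem residual_le {G : Type*} [Group G] {N : Subgroup G} (h : N.Normal)
    (h' : IsSigmaNilpotent σ (G ⧸ N)) : sigmaNilpotentResidual σ G ≤ N :=
  sInf_le ⟨h, h'⟩

theorem residual_le_comap (hσ : IsPrimePartition σ) {G A : Type*} [Group G] [Finite G] [Group A]
    [Finite A] (f : G →* A) :
    sigmaNilpotentResidual σ G ≤ (sigmaNilpotentResidual σ A).comap f := by
  obtain ⟨hn, hD⟩ := residual_mem hσ A
  refine residual_le inferInstance ?_
  refine (nil_iff_elt hσ).2 (EltNil.of_injective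
    (QuotientGroup.map _ (sigmaNilpotentResidual σ A) f le_rfl) ?_ ((nil_iff_elt hσ).1 hD))
  rw [← MonoidHom.ker_eq_bot_iff, eq_bot_iff]
  intro x
  induction x using QuotientGroup.induction_on with
  | H x =>
    intro h1
    have h1' : ((f x : A) : A ⧸ sigmaNilpotentResidual σ A) = 1 := h1
    rw [QuotientGroup.eq_one_iff] at h1'
    exact (QuotientGroup.eq_one_iff x).2 h1'

theorem residual_le_map (hσ : IsPrimePartition σ) {G A : Type*} [Group G] [Finite G] [Group A]
    [Finite A] (f : G →* A) (hf : Function.Surjective f) :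
    sigmaNilpotentResidual σ A ≤ (sigmaNilpotentResidual σ G).map f := by
  obtain ⟨hn, hD⟩ := residual_mem hσ G
  have hm := hn.map f hf
  refine residual_le hm ?_
  refine WeakNil.nil hσ (WeakNil.of_surjective
    (QuotientGroup.map (sigmaNilpotentResidual σ G) _ f (le_comap_map _ _)) ?_ hD.weak)
  intro y
  induction y using QuotientGroup.induction_on with
  | H y =>
    obtain ⟨x, rfl⟩ := hf y
    exact ⟨(x : G ⧸ _), rfl⟩

theorem residual_char (hσ : IsPrimePartition σ) (G : Type*) [Group G] [Finite G] :
    (sigmaNilpotentResidual σ G).Characteristic :=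
  characteristic_iff_le_comap.2 fun φ => residual_le_comap hσ φ.toMonoidHom

end Nilp

section Factors

/-- elementwise form of simplicity of the factor `H / K`. -/
def SimpFactor {G : Type*} [Group G] (K H : Subgroup G) : Prop :=
  K < H ∧ ∀ L : Subgroup G, K ≤ L → L ≤ H → (∀ h ∈ H, ∀ l ∈ L, h * l * h⁻¹ ∈ L) →
    L = K ∨ L = H

theorem simpFactor_iff {G : Type*} [Group G] (K H : Subgroup G) [K.Normal] (hlt : K < H) :
    SimpFactor K H ↔ IsSimpleGroup (↥H ⧸ K.subgroupOf H) := by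
  constructor
  · rintro ⟨_, hL⟩
    rw [isSimpleGroup_iff]
    constructor
    · rw [QuotientGroup.nontrivial_iff, Ne, subgroupOf_eq_top]
      exact not_le_of_gt hlt
    · intro X hX
      have hsurj := QuotientGroup.mk'_surjective (K.subgroupOf H)
      have hY : (X.comap (QuotientGroup.mk' (K.subgroupOf H))).Normal := hX.comap _
      have hKY : K.subgroupOf H ≤ X.comap (QuotientGroup.mk' (K.subgroupOf H)) := by
        intro x hx
        have : QuotientGroup.mk' (K.subgroupOf H) x = 1 := (QuotientGroup.eq_one_iff x).2 hx
        rw [mem_comap, this]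
        exact X.one_mem
      have hor := hL ((X.comap (QuotientGroup.mk' (K.subgroupOf H))).map H.subtype) ?_ ?_ ?_
      rcases hor with h | h
      · left
        rw [eq_bot_iff]
        intro x hx
        obtain ⟨y, rfl⟩ := hsurj x
        have : (y : G) ∈ K := by rw [← h]; exact ⟨y, hx, rfl⟩
        exact (QuotientGroup.eq_one_iff y).2 this
      · right
        rw [eq_top_iff]
        intro x _
        obtain ⟨y, rfl⟩ := hsurj x
        have hy : (y : G) ∈ (X.comap (QuotientGroup.mk' (K.subgroupOf H))).map H.subtype :=
          h.ge y.2
        obtain ⟨z, hz, hzy⟩ := hy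
        have : z = y := Subtype.ext hzy
        exact this ▸ hz
      · intro x hx
        exact ⟨⟨x, hlt.le hx⟩, hKY hx, rfl⟩
      · exact map_subtype_le _
      · rintro h hh _ ⟨y, hy, rfl⟩
        exact ⟨⟨h, hh⟩ * y * ⟨h, hh⟩⁻¹, hY.conj_mem y hy _, rfl⟩
  · intro hs
    refine ⟨hlt, fun L hKL hLH hn => ?_⟩
    have hLn : (L.subgroupOf H).Normal := ⟨fun x hx g => hn g g.2 x hx⟩
    have hmn := hLn.map _ (QuotientGroup.mk'_surjective (K.subgroupOf H))
    rcases hmn.eq_bot_or_eq_top with h | h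
    · left
      refine le_antisymm (fun x hx => ?_) hKL
      have : QuotientGroup.mk' (K.subgroupOf H) ⟨x, hLH hx⟩ ∈
          (L.subgroupOf H).map (QuotientGroup.mk' (K.subgroupOf H)) := ⟨⟨x, hLH hx⟩, hx, rfl⟩
      rw [h, mem_bot] at this
      exact (QuotientGroup.eq_one_iff (⟨x, hLH hx⟩ : H)).1 this
    · right
      refine le_antisymm hLH (fun x hx => ?_)
      have : QuotientGroup.mk' (K.subgroupOf H) ⟨x, hx⟩ ∈
          (L.subgroupOf H).map (QuotientGroup.mk' (K.subgroupOf H)) := by rw [h]; trivial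
      obtain ⟨y, hy, hyx⟩ := this
      have h1 : y⁻¹ * (⟨x, hx⟩ : H) ∈ K.subgroupOf H := QuotientGroup.eq.1 hyx
      have h2 : (y : G)⁻¹ * x ∈ L := hKL h1
      have h3 : (y : G) ∈ L := hy
      have := L.mul_mem h3 h2
      rwa [mul_inv_cancel_left] at this

theorem sc_iff {ι : Type*} {σ : ι → Set ℕ} {G : Type*} [Group G] :
    IsSigmaSCGroup σ G ↔ ∀ K H : Subgroup G, IsChiefFactor G K H →
      H ≤ sigmaNilpotentResidual σ G → SimpFactor K H := by
  constructor
  · intro h K H hc hle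
    have := hc.1
    exact (simpFactor_iff K H hc.2.2.1).2 (h K H hc hle)
  · intro h K H hc hle
    have := hc.1
    exact (simpFactor_iff K H hc.2.2.1).1 (h K H hc hle)

variable {G : Type*} [Group G]

/-- Dedekind's law, first form. -/
theorem ded1 {A B C : Subgroup G} [B.Normal] (h : A ≤ C) : (A ⊔ B) ⊓ C ≤ A ⊔ (B ⊓ C) := by
  rintro x ⟨hx, hxC⟩
  obtain ⟨a, ha, b, hb, rfl⟩ := mem_sup_of_normal_right.1 hx
  exact mul_mem_sup ha ⟨hb, (C.mul_mem_cancel_left (h ha)).1 hxC⟩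

/-- Dedekind's law, second form. -/
theorem ded2 {A B C : Subgroup G} [B.Normal] (h : B ≤ C) : (A ⊔ B) ⊓ C ≤ (A ⊓ C) ⊔ B := by
  rintro x ⟨hx, hxC⟩
  obtain ⟨a, ha, b, hb, rfl⟩ := mem_sup_of_normal_right.1 hx
  exact mul_mem_sup ⟨ha, (C.mul_mem_cancel_right (h hb)).1 hxC⟩ hb

theorem lt_persp {H M : Subgroup G} : H ⊓ M < H ↔ M < H ⊔ M := by
  rw [inf_lt_left, right_lt_sup]

theorem simp_persp (H M : Subgroup G) [H.Normal] [M.Normal] :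
    SimpFactor (H ⊓ M) H ↔ SimpFactor M (H ⊔ M) := by
  by_cases hlt : H ⊓ M < H
  · have hlt' := lt_persp.1 hlt
    rw [simpFactor_iff _ _ hlt, simpFactor_iff _ _ hlt',
      ← (QuotientGroup.quotientInfEquivProdNormalQuotient H M).isSimpleGroup_congr]
    exact (QuotientGroup.quotientMulEquivOfEq (inf_subgroupOf_left M H)).isSimpleGroup_congr
  · exact iff_of_false (fun h => hlt h.1) (fun h => hlt (lt_persp.2 h.1))

theorem chief_persp (H M : Subgroup G) [H.Normal] [M.Normal] :
    IsChiefFactor G (H ⊓ M) H ↔ IsChiefFactor G M (H ⊔ M) := by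
  constructor
  · rintro ⟨_, _, hlt, hc⟩
    refine ⟨inferInstance, inferInstance, lt_persp.1 hlt, fun L hL hML hLH => ?_⟩
    rcases hc (H ⊓ L) inferInstance (inf_le_inf_left _ hML) inf_le_left with h | h
    · left
      refine le_antisymm ?_ hML
      refine (le_inf hLH le_rfl).trans ((ded2 hML).trans ?_)
      rw [h]
      exact sup_le inf_le_right le_rfl
    · right
      exact le_antisymm hLH (sup_le (inf_eq_left.1 h) hML)
  · rintro ⟨_, _, hlt, hc⟩
    refine ⟨inferInstance, inferInstance, lt_persp.2 hlt, fun L hL hML hLH => ?_⟩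
    rcases hc (L ⊔ M) inferInstance le_sup_right (sup_le_sup_right hLH _) with h | h
    · left
      exact le_antisymm (le_inf hLH (sup_eq_right.1 h)) hML
    · right
      refine le_antisymm hLH ?_
      have h1 : H ≤ (L ⊔ M) ⊓ H := le_inf (h ▸ le_sup_left) le_rfl
      refine h1.trans ((ded1 hLH).trans (sup_le le_rfl ?_))
      rwa [inf_comm]

/-- going down: `H ≤ K A`. -/
theorem down_eqs {K H A : Subgroup G} [K.Normal] [A.Normal] (hKH : K ≤ H) (h : H ≤ K ⊔ A) :
    (H ⊓ A) ⊔ K = H ∧ (H ⊓ A) ⊓ K = K ⊓ A := by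
  constructor
  · refine le_antisymm (sup_le inf_le_left hKH) ?_
    refine (le_inf h le_rfl).trans ((ded1 hKH).trans ?_)
    rw [sup_comm, inf_comm]
  · rw [inf_right_comm, inf_eq_right.2 hKH]

theorem chief_down {K H A : Subgroup G} [A.Normal] (hc : IsChiefFactor G K H)
    (h : H ≤ K ⊔ A) : IsChiefFactor G (K ⊓ A) (H ⊓ A) := by
  have := hc.1
  have := hc.2.1
  obtain ⟨h1, h2⟩ := down_eqs hc.2.2.1.le h
  rw [← h2, chief_persp, h1]
  exact hc

theorem simp_down {K H A : Subgroup G} [A.Normal] [K.Normal] [H.Normal] (hKH : K ≤ H)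
    (h : H ≤ K ⊔ A) : SimpFactor (K ⊓ A) (H ⊓ A) ↔ SimpFactor K H := by
  obtain ⟨h1, h2⟩ := down_eqs hKH h
  rw [← h2, simp_persp, h1]

/-- going up: `H ∩ M = K`. -/
theorem chief_up {K H M : Subgroup G} [M.Normal] (hc : IsChiefFactor G K H)
    (h : H ⊓ M = K) : IsChiefFactor G M (H ⊔ M) := by
  have := hc.2.1
  rw [← chief_persp, h]; exact hc

theorem chief_or {K H M : Subgroup G} [M.Normal] (hc : IsChiefFactor G K H) :
    H ⊓ (K ⊔ M) = K ∨ H ≤ K ⊔ M := by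
  have := hc.1
  have := hc.2.1
  rcases hc.2.2.2 (H ⊓ (K ⊔ M)) inferInstance (le_inf hc.2.2.1.le le_sup_left) inf_le_left with h | h
  · exact Or.inl h
  · exact Or.inr (inf_eq_left.1 h)

variable {Q : Type*} [Group Q]

theorem chief_comap {f : G →* Q} (hf : Function.Surjective f) {K H : Subgroup Q} :
    IsChiefFactor G (K.comap f) (H.comap f) ↔ IsChiefFactor Q K H := by
  constructor
  · rintro ⟨hK, hH, hlt, hc⟩
    refine ⟨?_, ?_, (comap_lt_comap_of_surjective hf).1 hlt, fun L hL h1 h2 => ?_⟩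
    · rw [← map_comap_eq_self_of_surjective hf K]; exact hK.map f hf
    · rw [← map_comap_eq_self_of_surjective hf H]; exact hH.map f hf
    · exact (hc (L.comap f) (hL.comap f) (comap_mono h1) (comap_mono h2)).imp
        (fun h => comap_injective hf h) (fun h => comap_injective hf h)
  · rintro ⟨hK, hH, hlt, hc⟩
    refine ⟨hK.comap f, hH.comap f, (comap_lt_comap_of_surjective hf).2 hlt,
      fun L hL h1 h2 => ?_⟩
    have hk : f.ker ≤ L := le_trans (f.ker_le_comap K) h1
    have hL' : (L.map f).comap f = L := comap_map_eq_self hk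
    have hor := hc (L.map f) (hL.map f hf) ?_ ?_
    rcases hor with h | h
    · left; rw [← hL', h]
    · right; rw [← hL', h]
    · rwa [← comap_le_comap_of_surjective hf, hL']
    · rwa [← comap_le_comap_of_surjective hf, hL']

theorem simp_comap {f : G →* Q} (hf : Function.Surjective f) {K H : Subgroup Q} :
    SimpFactor (K.comap f) (H.comap f) ↔ SimpFactor K H := by
  constructor
  · rintro ⟨hlt, hc⟩
    refine ⟨(comap_lt_comap_of_surjective hf).1 hlt, fun L h1 h2 hn => ?_⟩
    refine (hc (L.comap f) (comap_mono h1) (comap_mono h2) ?_).imp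
        (fun h => comap_injective hf h) (fun h => comap_injective hf h)
    intro h hh l hl
    rw [mem_comap] at *
    simpa using hn (f h) hh (f l) hl
  · rintro ⟨hlt, hc⟩
    refine ⟨(comap_lt_comap_of_surjective hf).2 hlt, fun L h1 h2 hn => ?_⟩
    have hk : f.ker ≤ L := le_trans (f.ker_le_comap K) h1
    have hL' : (L.map f).comap f = L := comap_map_eq_self hk
    have hor := hc (L.map f) ?_ ?_ ?_
    rcases hor with h | h
    · left; rw [← hL', h]
    · right; rw [← hL', h]
    · rwa [← comap_le_comap_of_surjective hf, hL']
    · rwa [← comap_le_comap_of_surjective hf, hL']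
    · rintro h hh _ ⟨l, hl, rfl⟩
      obtain ⟨g, rfl⟩ := hf h
      exact ⟨g * l * g⁻¹, hn g hh l hl, by simp⟩

theorem simp_subgroupOf {K H N : Subgroup G} (hHN : H ≤ N) (h : SimpFactor K H) :
    SimpFactor (K.subgroupOf N) (H.subgroupOf N) := by
  obtain ⟨hlt, hc⟩ := h
  have key : ∀ X : Subgroup G, X ≤ N → (X.subgroupOf N).map N.subtype = X := fun X hX => by
    rw [subgroupOf_map_subtype, inf_eq_left.2 hX]
  have hKN := hlt.le.trans hHN
  have inj := map_injective N.subtype_injective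
  refine ⟨lt_of_le_of_ne (comap_mono hlt.le) fun he => hlt.ne ?_, fun L h1 h2 hn => ?_⟩
  · rw [← key K hKN, he, key H hHN]
  · have hor := hc (L.map N.subtype) ?_ ?_ ?_
    rcases hor with h | h
    · left; apply inj; rw [h, key K hKN]
    · right; apply inj; rw [h, key H hHN]
    · rw [← key K hKN]; exact map_mono h1
    · rw [← key H hHN]; exact map_mono h2
    · rintro h hh _ ⟨l, hl, rfl⟩
      exact ⟨⟨h, hHN hh⟩ * l * ⟨h, hHN hh⟩⁻¹, hn ⟨h, hHN hh⟩ hh l hl, rfl⟩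

end Factors

section Main

variable {ι : Type*} {σ : ι → Set ℕ}

theorem sc_image (hσ : IsPrimePartition σ) {G Q : Type*} [Group G] [Finite G] [Group Q] [Finite Q]
    (f : G →* Q) (hf : Function.Surjective f) (hG : IsSigmaSCGroup σ G) : IsSigmaSCGroup σ Q := by
  rw [sc_iff] at *
  intro K H hc hle
  obtain ⟨hD, _⟩ := residual_mem hσ G
  have hc' := (chief_comap hf).2 hc
  rw [← simp_comap hf]
  have hle' : H.comap f ≤ K.comap f ⊔ sigmaNilpotentResidual σ G := by
    refine (comap_mono (hle.trans (residual_le_map hσ f hf))).trans ?_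
    rw [comap_map_eq, sup_comm]
    exact sup_le_sup_right (f.ker_le_comap K) _
  have := hc'.1
  have := hc'.2.1
  rw [← simp_down hc'.2.2.1.le hle']
  exact hG _ _ (chief_down hc' hle') inf_le_right

/-- if `H ∩ K R = K` then the factor appears in `G / R`, where `R` is the kernel of `f`. -/
theorem sc_aux' (hσ : IsPrimePartition σ) {G Q : Type*} [Group G] [Finite G] [Group Q] [Finite Q]
    (f : G →* Q) (hf : Function.Surjective f) (R : Subgroup G) [R.Normal] (hk : f.ker = R)
    (hR : IsSigmaSCGroup σ Q) {K H : Subgroup G} (hc : IsChiefFactor G K H)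
    (hle : H ≤ sigmaNilpotentResidual σ G) (h : H ⊓ (K ⊔ R) = K) : SimpFactor K H := by
  rw [sc_iff] at hR
  have := hc.1
  have := hc.2.1
  have hc' := chief_up hc h
  have hs := simp_persp H (K ⊔ R)
  rw [h] at hs
  rw [hs]
  have e1 : ((K ⊔ R).map f).comap f = K ⊔ R :=
    comap_map_eq_self (hk.le.trans le_sup_right)
  have e2 : ((H ⊔ (K ⊔ R)).map f).comap f = H ⊔ (K ⊔ R) :=
    comap_map_eq_self (hk.le.trans (le_sup_right.trans le_sup_right))
  have hsc := simp_comap hf (K := (K ⊔ R).map f) (H := (H ⊔ (K ⊔ R)).map f)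
  have hcc := chief_comap hf (K := (K ⊔ R).map f) (H := (H ⊔ (K ⊔ R)).map f)
  rw [e1, e2] at hsc hcc
  refine hsc.2 (hR _ _ (hcc.1 hc') ?_)
  rw [map_le_iff_le_comap]
  refine sup_le ?_ (sup_le ?_ ?_)
  · exact hle.trans (residual_le_comap hσ f)
  · exact hc.2.2.1.le.trans (hle.trans (residual_le_comap hσ f))
  · exact hk.ge.trans (f.ker_le_comap _)

theorem sc_aux (hσ : IsPrimePartition σ) {G : Type*} [Group G] [Finite G] (R : Subgroup G)
    [R.Normal] (hR : IsSigmaSCGroup σ (G ⧸ R)) {K H : Subgroup G} (hc : IsChiefFactor G K H)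
    (hle : H ≤ sigmaNilpotentResidual σ G) (h : H ⊓ (K ⊔ R) = K) : SimpFactor K H :=
  sc_aux' hσ (QuotientGroup.mk' R) (QuotientGroup.mk'_surjective R) R (QuotientGroup.ker_mk' R)
    hR hc hle h

theorem sc_subdirect (hσ : IsPrimePartition σ) {G : Type*} [Group G] [Finite G] (R N : Subgroup G)
    [R.Normal] [N.Normal] (hRN : R ⊓ N = ⊥) (hR : IsSigmaSCGroup σ (G ⧸ R))
    (hN : IsSigmaSCGroup σ (G ⧸ N)) : IsSigmaSCGroup σ G := by
  rw [sc_iff]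
  intro K H hc hle
  rcases chief_or (M := R) hc with h | h
  · exact sc_aux hσ R hR hc hle h
  · have := hc.1
    have := hc.2.1
    rw [← simp_down hc.2.2.1.le h]
    have hc' := chief_down hc h
    refine sc_aux hσ N hN hc' (inf_le_left.trans hle) ?_
    refine le_antisymm ?_ (le_inf hc'.2.2.1.le le_sup_left)
    rw [inf_comm]
    refine (ded1 hc'.2.2.1.le).trans (sup_le le_rfl ?_)
    have : N ⊓ (H ⊓ R) ≤ R ⊓ N := le_inf (inf_le_right.trans inf_le_right) inf_le_left
    rw [hRN] at this
    exact this.trans bot_le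

theorem sc_normal (hσ : IsPrimePartition σ) {G : Type*} [Group G] [Finite G] (N : Subgroup G)
    (hN : N.Normal) (hG : IsSigmaSCGroup σ G) : IsSigmaSCGroup σ N := by
  rw [sc_iff] at *
  intro K H hc hle
  have hK := hc.1
  have hH := hc.2.1
  have hchar := residual_char hσ N
  set E := (sigmaNilpotentResidual σ N).map N.subtype with hE
  have hEn : E.Normal := inferInstance
  have hEN : E ≤ N := map_subtype_le _
  have hED : E ≤ sigmaNilpotentResidual σ G := by
    rw [hE, map_le_iff_le_comap]
    exact residual_le_comap hσ N.subtype
  obtain ⟨B, hB⟩ := (Set.toFinite {B : Subgroup G | B.Normal ∧ B ≤ E ∧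
    B.subgroupOf N ⊓ H ≤ K}).exists_maximal ⟨⊥, inferInstance, bot_le, by simp⟩
  obtain ⟨⟨hBn, hBE, hBK⟩, hBmax⟩ := hB
  have hBne : B ≠ E := by
    rintro rfl
    refine hc.2.2.1.not_ge (le_trans (le_inf ?_ le_rfl) hBK)
    refine hle.trans ?_
    intro x hx
    exact ⟨x, hx, rfl⟩
  obtain ⟨A, hA⟩ := (Set.toFinite {A : Subgroup G | A.Normal ∧ A ≤ E ∧ B < A}).exists_minimal
    ⟨E, hEn, le_rfl, lt_of_le_of_ne hBE hBne⟩
  obtain ⟨⟨hAn, hAE, hBA⟩, hAmin⟩ := hA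
  have hcf : IsChiefFactor G B A := by
    refine ⟨hBn, hAn, hBA, fun L hL h1 h2 => ?_⟩
    by_cases hBL : L = B
    · exact Or.inl hBL
    · exact Or.inr (le_antisymm h2 (hAmin ⟨hL, h2.trans hAE, lt_of_le_of_ne h1 (Ne.symm hBL)⟩ h2))
  have hS := simp_subgroupOf (hAE.trans hEN) (hG B A hcf (hAE.trans hED))
  have hAK : ¬ A.subgroupOf N ⊓ H ≤ K := fun h =>
    hBA.not_ge (hBmax ⟨hAn, hAE, h⟩ hBA.le)
  have hBA' : B.subgroupOf N ≤ A.subgroupOf N := comap_mono hBA.le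
  have i1 : (A.subgroupOf N).Normal := inferInstance
  have i2 : (B.subgroupOf N).Normal := inferInstance
  generalize A.subgroupOf N = A' at *
  generalize B.subgroupOf N = B' at *
  have hHA : H ≤ K ⊔ A' := by
    rcases chief_or (M := A') hc with h | h
    · exfalso
      apply hAK
      rw [← h, inf_comm]
      exact inf_le_inf_left _ le_sup_right
    · exact h
  rw [← simp_down hc.2.2.1.le hHA]
  have hlt : K ⊓ A' < H ⊓ A' := (chief_down hc hHA).2.2.1
  have heq : (H ⊓ A') ⊓ ((K ⊓ A') ⊔ B') = K ⊓ A' := by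
    refine le_antisymm ?_ (le_inf hlt.le le_sup_left)
    rw [inf_comm]
    refine (ded1 hlt.le).trans (sup_le le_rfl (le_inf (le_trans ?_ hBK) ?_))
    · exact inf_le_inf_left _ inf_le_left
    · exact inf_le_right.trans inf_le_right
  have hs := simp_persp (H ⊓ A') ((K ⊓ A') ⊔ B')
  rw [heq] at hs
  have hlt2 : (K ⊓ A') ⊔ B' < (H ⊓ A') ⊔ ((K ⊓ A') ⊔ B') := by
    rw [← lt_persp, heq]; exact hlt
  have hMA : (K ⊓ A') ⊔ B' ≤ A' := sup_le inf_le_right hBA'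
  have hHMA : (H ⊓ A') ⊔ ((K ⊓ A') ⊔ B') ≤ A' := sup_le inf_le_right hMA
  have nrm : ∀ X : Subgroup N, X.Normal → ∀ h ∈ A', ∀ l ∈ X, h * l * h⁻¹ ∈ X :=
    fun X hX h _ l hl => hX.conj_mem l hl h
  have e1 : (K ⊓ A') ⊔ B' = B' :=
    (hS.2 _ le_sup_right hMA (nrm _ inferInstance)).resolve_right
      (fun h => (hlt2.trans_le hHMA).ne h)
  have e2 : (H ⊓ A') ⊔ ((K ⊓ A') ⊔ B') = A' :=
    (hS.2 _ (le_sup_right.trans le_sup_right) hHMA (nrm _ inferInstance)).resolve_left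
      (fun h => (lt_of_le_of_lt le_sup_right hlt2).ne' h)
  rw [hs, e2, e1]
  exact hS

end Main

/-- The class of finite σ-SC-groups is closed under homomorphic images,
subdirect products and normal subgroups. -/
theorem statement_15.{u, v} {ι : Type*} (σ : ι → Set ℕ) (hσ : IsPrimePartition σ) :
    (∀ (G : Type u) [Group G] [Finite G] (H : Type v) [Group H] [Finite H]
        (f : G →* H), Function.Surjective f → IsSigmaSCGroup σ G →
        IsSigmaSCGroup σ H) ∧
    (∀ (G : Type u) [Group G] [Finite G] (R N : Subgroup G)
        [R.Normal] [N.Normal], R ⊓ N = ⊥ →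
        IsSigmaSCGroup σ (G ⧸ R) → IsSigmaSCGroup σ (G ⧸ N) →
        IsSigmaSCGroup σ G) ∧
    (∀ (G : Type u) [Group G] [Finite G] (N : Subgroup G), N.Normal →
        IsSigmaSCGroup σ G → IsSigmaSCGroup σ ↥N) := by
  exact ⟨fun G _ _ H _ _ f hf hG => sc_image hσ f hf hG,
    fun G _ _ R N _ _ hRN hR hN => sc_subdirect hσ R N hRN hR hN,
    fun G _ _ N hN hG => sc_normal hσ N hN hG⟩
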